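/- arXiv:1606.06777 — 2 statements merged into one kernel-verified Lean document; each statement's English description precedes it below -/
import Mathlib

section
/- Every small inverse category C admits a faithful functor into PInj, sending an object X to the disjoint union over all objects Z of Hom(Z, X), and a morphism f : X → Y to the partial injection g ↦ f ∘ g defined on those g : Z → X with g = f⁻¹ ∘ f ∘ g (whose image consists of those h : Z → Y with h = f ∘ f⁻¹ ∘ h). -/
open CategoryTheory

universe v u

/-- The action on morphisms of the representation of a small inverse category in
the category of sets and partial injections: `f : X ⟶ Y` is sent to the partial
injection `g ↦ g ≫ f` defined on those `g : Z ⟶ X` with `g ≫ f ≫ f⁻¹ = g`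
(i.e. `g = f⁻¹ ∘ f ∘ g`). -/
def psi {C : Type u} [Category.{v} C] (pinv : ∀ {X Y : C}, (X ⟶ Y) → (Y ⟶ X))
    {X Y : C} (f : X ⟶ Y) : (Σ Z : C, Z ⟶ X) →. (Σ Z : C, Z ⟶ Y) :=
  fun g => ⟨g.2 ≫ f ≫ pinv f = g.2, fun _ => ⟨g.1, g.2 ≫ f⟩⟩

theorem comp_idem_of_unique_pinv {C : Type u} [Category.{v} C]
    (pinv : ∀ {X Y : C}, (X ⟶ Y) → (Y ⟶ X))
    (h1 : ∀ {X Y : C} (f : X ⟶ Y), f ≫ pinv f ≫ f = f)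
    (h2 : ∀ {X Y : C} (f : X ⟶ Y), pinv f ≫ f ≫ pinv f = pinv f)
    (huniq : ∀ {X Y : C} (f : X ⟶ Y) (g : Y ⟶ X),
      f ≫ g ≫ f = f → g ≫ f ≫ g = g → g = pinv f)
    {X : C} {e f : X ⟶ X} (he : e ≫ e = e) (hf : f ≫ f = f) :
    (e ≫ f) ≫ e ≫ f = e ≫ f := by
  have k1 := h1 (e ≫ f)
  have k2 := h2 (e ≫ f)
  have k3 := huniq (e ≫ f)
  generalize pinv (e ≫ f) = a at k1 k2 k3
  simp only [Category.assoc] at k1 k2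
  have he' : ∀ {W : C} (x : X ⟶ W), e ≫ e ≫ x = e ≫ x := fun x => by
    rw [← Category.assoc, he]
  have hf' : ∀ {W : C} (x : X ⟶ W), f ≫ f ≫ x = f ≫ x := fun x => by
    rw [← Category.assoc, hf]
  have k2' : ∀ {W : C} (x : X ⟶ W), a ≫ e ≫ f ≫ a ≫ x = a ≫ x := fun x => by
    simpa only [Category.assoc] using congrArg (· ≫ x) k2
  have ha : f ≫ a ≫ e = a := k3 _ (by simp only [Category.assoc, he', hf', k1])
    (by simp only [Category.assoc, he', hf', k2'])
  have haa : a ≫ a = a := by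
    calc a ≫ a = (f ≫ a ≫ e) ≫ f ≫ a ≫ e := by rw [ha]
      _ = f ≫ (a ≫ e ≫ f ≫ a) ≫ e := by simp only [Category.assoc]
      _ = a := by rw [k2, ha]
  have hea : e ≫ f = a :=
    (huniq a (e ≫ f) (by simpa only [Category.assoc] using k2)
      (by simpa only [Category.assoc] using k1)).trans
      (huniq a a (by rw [haa, haa]) (by rw [haa, haa])).symm
  rw [hea, haa]

theorem idem_comm_of_unique_pinv {C : Type u} [Category.{v} C]
    (pinv : ∀ {X Y : C}, (X ⟶ Y) → (Y ⟶ X))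
    (h1 : ∀ {X Y : C} (f : X ⟶ Y), f ≫ pinv f ≫ f = f)
    (h2 : ∀ {X Y : C} (f : X ⟶ Y), pinv f ≫ f ≫ pinv f = pinv f)
    (huniq : ∀ {X Y : C} (f : X ⟶ Y) (g : Y ⟶ X),
      f ≫ g ≫ f = f → g ≫ f ≫ g = g → g = pinv f)
    {X : C} {e f : X ⟶ X} (he : e ≫ e = e) (hf : f ≫ f = f) :
    e ≫ f = f ≫ e := by
  have hef := comp_idem_of_unique_pinv pinv h1 h2 huniq he hf
  have hfe := comp_idem_of_unique_pinv pinv h1 h2 huniq hf he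
  have he' : ∀ {W : C} (x : X ⟶ W), e ≫ e ≫ x = e ≫ x := fun x => by
    rw [← Category.assoc, he]
  have hf' : ∀ {W : C} (x : X ⟶ W), f ≫ f ≫ x = f ≫ x := fun x => by
    rw [← Category.assoc, hf]
  refine (huniq (e ≫ f) (e ≫ f) (by rw [hef, hef]) (by rw [hef, hef])).trans
    (huniq (e ≫ f) (f ≫ e) ?_ ?_).symm
  · simpa only [Category.assoc, he', hf'] using hef
  · simpa only [Category.assoc, he', hf'] using hfe

theorem pinv_comp_of_unique_pinv {C : Type u} [Category.{v} C]
    (pinv : ∀ {X Y : C}, (X ⟶ Y) → (Y ⟶ X))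
    (h1 : ∀ {X Y : C} (f : X ⟶ Y), f ≫ pinv f ≫ f = f)
    (h2 : ∀ {X Y : C} (f : X ⟶ Y), pinv f ≫ f ≫ pinv f = pinv f)
    (huniq : ∀ {X Y : C} (f : X ⟶ Y) (g : Y ⟶ X),
      f ≫ g ≫ f = f → g ≫ f ≫ g = g → g = pinv f)
    {X Y Z : C} (f : X ⟶ Y) (g : Y ⟶ Z) :
    pinv (f ≫ g) = pinv g ≫ pinv f := by
  have hc : (pinv f ≫ f) ≫ g ≫ pinv g = (g ≫ pinv g) ≫ pinv f ≫ f :=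
    idem_comm_of_unique_pinv pinv h1 h2 huniq
      (by rw [Category.assoc, h1]) (by rw [Category.assoc, h2])
  refine (huniq _ _ ?_ ?_).symm
  · calc (f ≫ g) ≫ (pinv g ≫ pinv f) ≫ f ≫ g
        = f ≫ ((g ≫ pinv g) ≫ pinv f ≫ f) ≫ g := by simp only [Category.assoc]
      _ = (f ≫ pinv f ≫ f) ≫ g ≫ pinv g ≫ g := by
        rw [← hc]; simp only [Category.assoc]
      _ = f ≫ g := by rw [h1, h1]
  · calc (pinv g ≫ pinv f) ≫ (f ≫ g) ≫ pinv g ≫ pinv f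
        = pinv g ≫ ((pinv f ≫ f) ≫ g ≫ pinv g) ≫ pinv f := by simp only [Category.assoc]
      _ = (pinv g ≫ g ≫ pinv g) ≫ pinv f ≫ f ≫ pinv f := by
        rw [hc]; simp only [Category.assoc]
      _ = pinv g ≫ pinv f := by rw [h2, h2]

theorem mem_psi {C : Type u} [Category.{v} C] (pinv : ∀ {X Y : C}, (X ⟶ Y) → (Y ⟶ X))
    {X Y : C} (f : X ⟶ Y) (a : Σ Z : C, Z ⟶ X) (b : Σ Z : C, Z ⟶ Y) :
    b ∈ psi pinv f a ↔ a.2 ≫ f ≫ pinv f = a.2 ∧ ⟨a.1, a.2 ≫ f⟩ = b := by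
  simp only [psi, Part.mem_mk_iff, exists_prop]

/-- Every small inverse category admits a faithful functor into `PInj`, sending
an object `X` to `Σ Z, (Z ⟶ X)` and a morphism `f` to the partial injection
`psi pinv f`: this assignment preserves identities and composition, lands in
partial injections, is faithful, and the image of `psi pinv f` consists of those
`h : Z ⟶ Y` with `h = f ∘ f⁻¹ ∘ h`. -/
theorem stmt_8 {C : Type u} [Category.{v} C]
    (pinv : ∀ {X Y : C}, (X ⟶ Y) → (Y ⟶ X))
    (h1 : ∀ {X Y : C} (f : X ⟶ Y), f ≫ pinv f ≫ f = f)
    (h2 : ∀ {X Y : C} (f : X ⟶ Y), pinv f ≫ f ≫ pinv f = pinv f)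
    (huniq : ∀ {X Y : C} (f : X ⟶ Y) (g : Y ⟶ X),
      f ≫ g ≫ f = f → g ≫ f ≫ g = g → g = pinv f) :
    (∀ X : C, psi pinv (𝟙 X) = PFun.id _) ∧
    (∀ {X Y Z : C} (f : X ⟶ Y) (g : Y ⟶ Z),
        psi pinv (f ≫ g) = (psi pinv g).comp (psi pinv f)) ∧
    (∀ {X Y : C} (f : X ⟶ Y) (a₁ a₂ : Σ Z : C, Z ⟶ X) (b : Σ Z : C, Z ⟶ Y),
        b ∈ psi pinv f a₁ → b ∈ psi pinv f a₂ → a₁ = a₂) ∧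
    (∀ {X Y : C} (f f' : X ⟶ Y), psi pinv f = psi pinv f' → f = f') ∧
    (∀ {X Y : C} (f : X ⟶ Y) (h : Σ Z : C, Z ⟶ Y),
        (∃ a, h ∈ psi pinv f a) ↔ h.2 ≫ pinv f ≫ f = h.2) := by
  have hcomm : ∀ {X Y Z : C} (f : X ⟶ Y) (g : X ⟶ Z),
      (f ≫ pinv f) ≫ g ≫ pinv g = (g ≫ pinv g) ≫ f ≫ pinv f := fun f g =>
    idem_comm_of_unique_pinv pinv h1 h2 huniq
      (by rw [Category.assoc, h2]) (by rw [Category.assoc, h2])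
  refine ⟨fun X => ?_, fun {X Y Z} f g => ?_, fun {X Y} f a₁ a₂ b hb₁ hb₂ => ?_,
    fun {X Y} f f' hff => ?_, fun {X Y} f h => ⟨?_, fun hh => ?_⟩⟩
  · have hid : pinv (𝟙 X) = 𝟙 X := (huniq (𝟙 X) (𝟙 X) (by simp) (by simp)).symm
    refine PFun.ext fun a b => ?_
    rw [mem_psi, hid]
    simp [PFun.id, eq_comm]
  · refine PFun.ext fun a b => ?_
    obtain ⟨W, h⟩ := a
    refine Iff.trans ?_ Part.mem_bind_iff.symm
    simp only [mem_psi]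
    rw [pinv_comp_of_unique_pinv pinv h1 h2 huniq]
    constructor
    · rintro ⟨hd, rfl⟩
      have hf : h ≫ f ≫ pinv f = h := by
        calc h ≫ f ≫ pinv f
            = (h ≫ (f ≫ g) ≫ pinv g ≫ pinv f) ≫ f ≫ pinv f := by rw [hd]
          _ = h ≫ (f ≫ g) ≫ pinv g ≫ pinv f ≫ f ≫ pinv f := by
            simp only [Category.assoc]
          _ = h := by rw [h2, hd]
      have hc : (pinv f ≫ f) ≫ g ≫ pinv g = (g ≫ pinv g) ≫ pinv f ≫ f :=
        idem_comm_of_unique_pinv pinv h1 h2 huniq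
          (by rw [Category.assoc, h1]) (by rw [Category.assoc, h2])
      refine ⟨⟨W, h ≫ f⟩, ⟨hf, rfl⟩, ?_, by simp only [Category.assoc]⟩
      calc (h ≫ f) ≫ g ≫ pinv g = (h ≫ f ≫ pinv f ≫ f) ≫ g ≫ pinv g := by rw [h1]
        _ = (h ≫ f) ≫ (pinv f ≫ f) ≫ g ≫ pinv g := by simp only [Category.assoc]
        _ = (h ≫ (f ≫ g) ≫ pinv g ≫ pinv f) ≫ f := by
          rw [hc]; simp only [Category.assoc]
        _ = h ≫ f := by rw [hd]
    · rintro ⟨_, ⟨hf, rfl⟩, hg, rfl⟩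
      refine ⟨?_, by simp only [Category.assoc]⟩
      calc h ≫ (f ≫ g) ≫ pinv g ≫ pinv f = ((h ≫ f) ≫ g ≫ pinv g) ≫ pinv f := by
            simp only [Category.assoc]
        _ = h ≫ f ≫ pinv f := by rw [hg, Category.assoc]
        _ = h := hf
  · obtain ⟨Z₁, g₁⟩ := a₁
    obtain ⟨Z₂, g₂⟩ := a₂
    rw [mem_psi] at hb₁ hb₂
    obtain ⟨hd₁, rfl⟩ := hb₁
    obtain ⟨hd₂, hb⟩ := hb₂
    obtain ⟨rfl, hb⟩ := Sigma.mk.inj_iff.1 hb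
    have hb := eq_of_heq hb
    dsimp only at hd₁ hd₂ hb
    rw [← hd₁, ← hd₂, ← Category.assoc, ← Category.assoc, hb]
  · have key : ∀ p q : X ⟶ Y, psi pinv p = psi pinv q →
        (p ≫ pinv p) ≫ q ≫ pinv q = p ≫ pinv p ∧ (p ≫ pinv p) ≫ q = p := by
      intro p q hpq
      have hm : (⟨X, p⟩ : Σ Z : C, Z ⟶ Y) ∈ psi pinv p ⟨X, p ≫ pinv p⟩ := by
        rw [mem_psi]
        simp only [Category.assoc, h1, h2, and_self]
      rw [hpq, mem_psi] at hm
      exact ⟨hm.1, eq_of_heq (Sigma.mk.inj_iff.1 hm.2).2⟩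
    obtain ⟨hd, hv⟩ := key f f' hff
    obtain ⟨hd', -⟩ := key f' f hff.symm
    rw [← hv, ← hd, hcomm, hd', Category.assoc, h1]
  · rintro ⟨a, ha⟩
    obtain ⟨-, rfl⟩ := (mem_psi pinv f a h).1 ha
    simp only [Category.assoc, h1]
  · refine ⟨⟨h.1, h.2 ≫ pinv f⟩, (mem_psi _ _ _ _).2 ⟨?_, ?_⟩⟩
    · simp only [Category.assoc, h2]
    · simp only [Category.assoc, hh]
end

section
/- Let I be a category such that every I-shaped diagram in every category with the amalgamation property has a cocone. Then I is connected. -/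
open CategoryTheory

universe v u

/-- The lifted type of objects of `I`, preordered by the existence of a zigzag. As a category it
is equivalent to the discrete category of connected components of `I`. -/
@[reducible]
def zigzagPreorder (I : Type u) [Category.{v} I] : Preorder (ULift.{v} I) where
  le X Y := Zigzag X.down Y.down
  le_refl X := Zigzag.refl X.down
  le_trans _ _ _ := Zigzag.trans

/-- If every `I`-shaped diagram in every category with the amalgamation
property has a cocone, then `I` is connected: it is nonempty and any two of
its objects are joined by a finite zigzag of morphisms. -/
theorem stmt_17 {I : Type u} [Category.{v} I]
    (h : ∀ (C : Type (max u v)) [Category.{max u v} C],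
      (∀ {A B D : C} (f : A ⟶ B) (g : A ⟶ D),
        ∃ (X : C) (h : B ⟶ X) (k : D ⟶ X), f ≫ h = g ≫ k) →
      ∀ F : I ⥤ C, ∃ (X : C) (c : ∀ i : I, F.obj i ⟶ X),
        ∀ {i j : I} (f : i ⟶ j), F.map f ≫ c j = c i) :
    Nonempty I ∧ ∀ X Y : I, Zigzag X Y := by
  let _ : Preorder (ULift.{v} I) := zigzagPreorder I
  let F : I ⥤ ULift.{v} I :=
    { obj := ULift.up
      map := fun f => homOfLE (Zigzag.of_hom f) }
  obtain ⟨X, c, -⟩ := h (ULift.{v} I)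
    (fun {A _ _} f g => ⟨A, homOfLE (Zigzag.symm (leOfHom f)),
      homOfLE (Zigzag.symm (leOfHom g)), Subsingleton.elim _ _⟩) F
  have zigzag_vertex (i : I) : Zigzag i X.down := leOfHom (c i)
  exact ⟨⟨X.down⟩, fun i j => (zigzag_vertex i).trans (zigzag_vertex j).symm⟩
end
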